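/- Let L > 0 and let T and T̃ belong to TM(L), with entries T = [[A, B], [C, D]] and T̃ = [[Ã, B̃], [C̃, D̃]]. If the Weyl m-functions with Dirichlet–Neumann boundary conditions coincide, i.e. −B(z)/A(z) = −B̃(z)/Ã(z) for all z where both are defined (equivalently B(z)Ã(z) = B̃(z)A(z) for all z ∈ ℂ), then T = T̃. -/

import Mathlib

open Matrix ComplexOrder

/-- The symplectic matrix `J = [[0, -1], [1, 0]]`. -/
def Jmat : Matrix (Fin 2) (Fin 2) ℂ := !![0, -1; 1, 0]

/-- The class `TM` of transfer matrices: entire, determinant one, identity at `0`, real on the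
real axis (i.e. `T(z̄) = conj T(z)` entrywise), and `i(T(z)* J T(z) − J) ≥ 0` for `Im z ≥ 0`. -/
structure IsTM (T : ℂ → Matrix (Fin 2) (Fin 2) ℂ) : Prop where
  entire : ∀ i j, Differentiable ℂ fun z => T z i j
  det_one : ∀ z, (T z).det = 1
  init : T 0 = 1
  conj_symm : ∀ z, T (starRingEnd ℂ z) = (T z).map (starRingEnd ℂ)
  psd : ∀ z : ℂ, 0 ≤ z.im → (Complex.I • ((T z)ᴴ * Jmat * T z - Jmat)).PosSemidef

/-- The class `TM(L)`: members of `TM` with `C'(0) − B'(0) = L`, where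
`T = [[A, B], [C, D]]`. -/
def IsTML (L : ℝ) (T : ℂ → Matrix (Fin 2) (Fin 2) ℂ) : Prop :=
  IsTM T ∧ deriv (fun z => T z 1 0) 0 - deriv (fun z => T z 0 1) 0 = (L : ℂ)

section

open Complex Metric Set

/-- **Harnack's inequality** for holomorphic functions with nonnegative real part. -/
lemma norm_le_of_re_nonneg_on_ball {P : ℂ → ℂ} {c z : ℂ} {R t : ℝ} (ht : 0 < t)
    (hP : DifferentiableOn ℂ P (ball c R)) (hre : ∀ ζ ∈ ball c R, 0 ≤ (P ζ).re)
    (hz : dist z c + t ≤ R) : ‖P z‖ ≤ 2 * R / t * ‖P c‖ := by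
  have hd : 0 ≤ dist z c := dist_nonneg
  have hR : 0 < R := by linarith
  have hsub : ∀ w ∈ ball (0 : ℂ) R, c + w ∈ ball c R := fun w hw ↦ by
    simpa [mem_ball, dist_eq_norm] using hw
  have hzc : ‖z - c‖ = dist z c := (dist_eq_norm z c).symm
  have hM : ∀ M : ℝ, 0 < M →
      ‖P z‖ ≤ 2 * M * dist z c / (R - dist z c) + ‖P c‖ * (R + dist z c) / (R - dist z c) := by
    intro M hM
    have hdiff : DifferentiableOn ℂ (fun w ↦ -P (c + w)) (ball 0 R) :=
      (hP.comp (by fun_prop) hsub).neg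
    have h := borelCaratheodory (f := fun w ↦ -P (c + w)) (z := z - c) hM hdiff
      (fun w hw ↦ by
        have := hre _ (hsub w hw)
        simp only [mem_ofPred_eq, neg_re]
        linarith) hR (by
          rw [mem_ball_zero_iff, hzc]
          linarith)
    simpa [hzc] using h
  have hlim : ‖P z‖ ≤ ‖P c‖ * (R + dist z c) / (R - dist z c) := by
    refine le_of_forall_pos_le_add fun ε hε ↦ ?_
    have h := hM (ε * (R - dist z c) / (2 * R)) (by
      have : 0 < R - dist z c := by linarith
      positivity)
    have h2 : 2 * (ε * (R - dist z c) / (2 * R)) * dist z c / (R - dist z c) ≤ ε := by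
      have : R - dist z c ≠ 0 := by linarith
      have e : 2 * (ε * (R - dist z c) / (2 * R)) * dist z c / (R - dist z c)
          = ε * (dist z c / R) := by
        field_simp
      rw [e]
      have : dist z c / R ≤ 1 := by
        rw [div_le_one hR]
        linarith
      nlinarith
    linarith
  refine hlim.trans ?_
  rw [mul_div_assoc, mul_comm]
  gcongr <;> linarith

lemma norm_add_one_le_of_re_nonneg {P : ℂ → ℂ} {c z w : ℂ} {R s t : ℝ} (hs : 0 < s) (ht : 0 < t)
    (hP : DifferentiableOn ℂ P (ball c R)) (hre : ∀ ζ ∈ ball c R, 0 ≤ (P ζ).re)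
    (hz : dist z c + s ≤ R) (hw : dist w c + t ≤ R) :
    ‖P z + 1‖ ≤ 4 * R ^ 2 / (s * t) * ‖P w + 1‖ := by
  have hR : 0 < R := by linarith [dist_nonneg (x := z) (y := c)]
  have hpos : ∀ ζ ∈ ball c R, 0 < (P ζ + 1).re := fun ζ hζ ↦ by
    have := hre ζ hζ
    simp only [add_re, one_re]
    linarith
  have hne : ∀ ζ ∈ ball c R, P ζ + 1 ≠ 0 := fun ζ hζ h ↦ by
    have := hpos ζ hζ
    simp [h] at this
  have h1 := norm_le_of_re_nonneg_on_ball (P := fun ζ ↦ P ζ + 1) hs (hP.add_const 1)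
    (fun ζ hζ ↦ (hpos ζ hζ).le) hz
  have h2 := norm_le_of_re_nonneg_on_ball (P := fun ζ ↦ (P ζ + 1)⁻¹) ht ((hP.add_const 1).inv hne)
    (fun ζ hζ ↦ by
      rw [inv_re]
      exact div_nonneg (hpos ζ hζ).le (normSq_nonneg _)) hw
  simp only [norm_inv] at h2
  have hc : 0 < ‖P c + 1‖ := norm_pos_iff.2 (hne c (mem_ball_self hR))
  have hw' : 0 < ‖P w + 1‖ := norm_pos_iff.2 (hne w (by rw [mem_ball]; linarith))
  have h3 : ‖P c + 1‖ ≤ 2 * R / t * ‖P w + 1‖ := by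
    have : ‖P w + 1‖⁻¹ * (‖P c + 1‖ * ‖P w + 1‖) ≤
        2 * R / t * ‖P c + 1‖⁻¹ * (‖P c + 1‖ * ‖P w + 1‖) := by gcongr
    calc ‖P c + 1‖ = ‖P w + 1‖⁻¹ * (‖P c + 1‖ * ‖P w + 1‖) := by field_simp
      _ ≤ _ := this
      _ = _ := by field_simp
  calc ‖P z + 1‖ ≤ 2 * R / s * ‖P c + 1‖ := h1
    _ ≤ 2 * R / s * (2 * R / t * ‖P w + 1‖) := by gcongr
    _ = _ := by field_simp; ring

/-- Bound for the logarithmic derivative of a function bounded away from zero on a disc, in terms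
of its size at one point. -/
lemma norm_logDeriv_le_of_one_le {f : ℂ → ℂ} {c z w : ℂ} {R s t M : ℝ} (hs : 0 < s) (ht : 0 < t)
    (hM : 0 < M) (hf : DifferentiableOn ℂ f (ball c R)) (hlow : ∀ ζ ∈ ball c R, 1 ≤ M * ‖f ζ‖)
    (hz : dist z c + s ≤ R) (hw : dist w c + t ≤ R) :
    ‖logDeriv f z‖ ≤ 16 * R ^ 2 / (s ^ 2 * t) * (Real.log (M * ‖f w‖) + 5) := by
  have hne : ∀ ζ ∈ ball c R, f ζ ≠ 0 := fun ζ hζ h ↦ by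
    have := hlow ζ hζ
    simp [h] at this
    linarith
  have hwb : w ∈ ball c R := by rw [mem_ball]; linarith
  have hzb : z ∈ ball c R := by rw [mem_ball]; linarith
  have hfd : ∀ ζ ∈ ball c R, DifferentiableAt ℂ f ζ := fun ζ hζ ↦
    hf.differentiableAt (isOpen_ball.mem_nhds hζ)
  have hex : IsExactOn (logDeriv f) (ball c R) := by
    apply DifferentiableOn.isExactOn_ball
    exact (hf.deriv isOpen_ball).div hf hne
  obtain ⟨P, hPw, hP⟩ := hex.with_val_at w (Complex.log (M * f w))
  have hMw : (M : ℂ) * f w ≠ 0 := mul_ne_zero (by exact_mod_cast hM.ne') (hne w hwb)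
  have hPd : DifferentiableOn ℂ P (ball c R) := fun ζ hζ ↦
    (hP ζ hζ).differentiableAt.differentiableWithinAt
  have hexp : ∀ ζ ∈ ball c R, exp (P ζ) = M * f ζ := by
    have hconst : ∀ ζ ∈ ball c R, M * f ζ * exp (-P ζ) = M * f w * exp (-P w) := by
      intro ζ hζ
      refine isOpen_ball.is_const_of_deriv_eq_zero (convex_ball c R).isPreconnected
        (f := fun ζ ↦ M * f ζ * exp (-P ζ)) (((hf.const_mul _).mul hPd.neg.cexp))
        (fun x hx ↦ ?_) hζ hwb
      have hd := (((hfd x hx).hasDerivAt.const_mul (M : ℂ)).mul (hP x hx).neg.cexp)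
      refine hd.deriv.trans ?_
      rw [logDeriv_apply]
      have := hne x hx
      simp only [Pi.zero_apply]
      field_simp
      ring
    intro ζ hζ
    have h := hconst ζ hζ
    rw [hPw, Complex.exp_neg, Complex.exp_neg, exp_log hMw, mul_inv_cancel₀ hMw] at h
    field_simp at h
    exact h.symm
  have hre : ∀ ζ ∈ ball c R, 0 ≤ (P ζ).re := by
    intro ζ hζ
    have h := congrArg norm (hexp ζ hζ)
    rw [norm_exp, norm_mul, norm_real, Real.norm_of_nonneg hM.le] at h
    rw [← Real.one_le_exp_iff, h]
    exact hlow ζ hζ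
  have hPw1 : ‖P w + 1‖ ≤ Real.log (M * ‖f w‖) + 5 := by
    have h1 : ‖P w‖ ≤ |(P w).re| + |(P w).im| := norm_le_abs_re_add_abs_im _
    have h2 : ‖P w + 1‖ ≤ ‖P w‖ + 1 := by simpa using norm_add_le (P w) 1
    rw [abs_of_nonneg (hre w hwb), hPw, log_re, log_im, norm_mul, norm_real,
      Real.norm_of_nonneg hM.le] at h1
    have h3 := abs_arg_le_pi (M * f w)
    have := Real.pi_lt_four
    rw [← hPw] at h1
    linarith
  have hbd : ∀ ζ ∈ sphere z (s / 2), ‖P ζ + 1‖ ≤ 4 * R ^ 2 / (s / 2 * t) * ‖P w + 1‖ := by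
    intro ζ hζ
    refine norm_add_one_le_of_re_nonneg (by positivity) ht hPd hre ?_ hw
    have := dist_triangle ζ z c
    rw [mem_sphere] at hζ
    linarith
  have hder := norm_deriv_le_of_forall_mem_sphere_norm_le (f := fun ζ ↦ P ζ + 1) (half_pos hs)
    ((hPd.add_const 1).diffContOnCl_ball (closedBall_subset_ball' (by linarith))) hbd
  rw [((hP z hzb).add_const 1).deriv] at hder
  refine hder.trans ?_
  calc 4 * R ^ 2 / (s / 2 * t) * ‖P w + 1‖ / (s / 2)
      = 16 * R ^ 2 / (s ^ 2 * t) * ‖P w + 1‖ := by field_simp; ring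
    _ ≤ _ := by gcongr

/-- The open upper half-plane, as a set of complex numbers. -/
def uhp : Set ℂ := {z | 0 < z.im}

lemma isOpen_uhp : IsOpen uhp := isOpen_lt continuous_const continuous_im

/-- The weight `(1 + |z|²) / Im z`, which measures how deep a point of the upper half-plane lies. -/
noncomputable def wt (z : ℂ) : ℝ := (1 + ‖z‖ ^ 2) / z.im

lemma norm_sq_eq_re_im (z : ℂ) : ‖z‖ ^ 2 = z.re ^ 2 + z.im ^ 2 := by
  rw [Complex.sq_norm, normSq_apply]
  ring

lemma wt_mul_im {z : ℂ} (hz : 0 < z.im) : wt z * z.im = 1 + ‖z‖ ^ 2 := by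
  unfold wt
  field_simp

lemma two_le_wt {z : ℂ} (hz : 0 < z.im) : 2 ≤ wt z := by
  unfold wt
  rw [le_div_iff₀ hz, norm_sq_eq_re_im]
  nlinarith [sq_nonneg z.re, sq_nonneg (z.im - 1)]

lemma one_le_wt_mul_im {z : ℂ} (hz : 0 < z.im) : 1 ≤ wt z * z.im := by
  rw [wt_mul_im hz]
  nlinarith [sq_nonneg ‖z‖]

lemma dist_I_mul_le {z : ℂ} {ρ s : ℝ} (hs : s ≤ ρ)
    (h : z.re ^ 2 + (z.im - ρ) ^ 2 ≤ (ρ - s) ^ 2) : dist z (ρ * I) + s ≤ ρ := by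
  have : dist z (ρ * I) ≤ ρ - s := by
    rw [dist_eq_norm]
    refine le_of_sq_le_sq ?_ (by linarith)
    rw [norm_sq_eq_re_im]
    simpa using h
  linarith

lemma dist_wt_add_le {z : ℂ} (hz : 0 < z.im) : dist z (wt z * I) + z.im / 2 ≤ wt z := by
  have h1 := wt_mul_im hz
  have h2 := two_le_wt hz
  rw [norm_sq_eq_re_im] at h1
  apply dist_I_mul_le
  · nlinarith [sq_nonneg z.re, sq_nonneg z.im]
  · nlinarith [sq_nonneg z.re, sq_nonneg z.im]

lemma dist_I_add_le {ρ : ℝ} (hρ : 1 ≤ ρ) : dist I (ρ * I) + 1 ≤ ρ :=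
  dist_I_mul_le hρ (by
    simp only [I_re, I_im]
    nlinarith)

lemma lt_im_of_mem_ball {ζ : ℂ} {ρ δ : ℝ} (hζ : ζ ∈ ball ((ρ : ℂ) * I) (ρ - δ)) : δ < ζ.im := by
  rw [mem_ball, dist_eq_norm] at hζ
  have := abs_im_le_norm (ζ - ρ * I)
  simp only [sub_im, mul_im, ofReal_re, I_im, mul_one, ofReal_im, I_re, mul_zero, add_zero] at this
  have := neg_abs_le (ζ.im - ρ)
  linarith

lemma norm_le_of_mem_ball {ζ : ℂ} {ρ δ : ℝ} (hρ : 0 ≤ ρ) (hδ : 0 ≤ δ)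
    (hζ : ζ ∈ ball ((ρ : ℂ) * I) (ρ - δ)) : ‖ζ‖ ≤ 2 * ρ := by
  rw [mem_ball, dist_eq_norm] at hζ
  have h := norm_add_le (ζ - ρ * I) (ρ * I)
  rw [sub_add_cancel, norm_mul, norm_real, norm_I, mul_one, Real.norm_of_nonneg hρ] at h
  linarith

lemma wt_le_of_mem_ball {ζ : ℂ} {ρ δ : ℝ} (hρ : 0 ≤ ρ) (hδ : 0 < δ)
    (hζ : ζ ∈ ball ((ρ : ℂ) * I) (ρ - δ)) : wt ζ ≤ (1 + 4 * ρ ^ 2) / δ := by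
  have h1 := lt_im_of_mem_ball hζ
  have h2 := norm_le_of_mem_ball hρ hδ.le hζ
  unfold wt
  have : ‖ζ‖ ^ 2 ≤ (2 * ρ) ^ 2 := by gcongr
  gcongr
  linarith

/-- A Herglotz function has polynomial growth with respect to `wt`. -/
lemma exists_norm_le_wt_of_im_nonneg {F : ℂ → ℂ} (hF : DifferentiableOn ℂ F uhp)
    (him : ∀ z ∈ uhp, 0 ≤ (F z).im) : ∃ C, 0 < C ∧ ∀ z ∈ uhp, ‖F z‖ ≤ C * wt z ^ 3 := by
  refine ⟨32 * ‖-I * F I + 1‖ + 1, by positivity, fun z (hz : 0 < z.im) ↦ ?_⟩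
  have hW := two_le_wt hz
  have hWy := one_le_wt_mul_im hz
  have hd := dist_wt_add_le hz
  have hi := dist_I_add_le (ρ := wt z) (by linarith)
  set W := wt z
  have hδ : 0 < 1 / (4 * W) := by positivity
  have hδ2 : 1 / (4 * W) ≤ z.im / 4 := by
    rw [div_le_div_iff₀ (by positivity) (by positivity)]
    linarith
  have hδ3 : 1 / (4 * W) ≤ 1 / 2 := by
    rw [div_le_div_iff₀ (by positivity) (by positivity)]
    linarith
  have hsub : ball ((W : ℂ) * I) (W - 1 / (4 * W)) ⊆ uhp := fun ζ hζ ↦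
    hδ.trans (lt_im_of_mem_ball hζ)
  have h := norm_add_one_le_of_re_nonneg (P := fun ζ ↦ -I * F ζ) (z := z) (w := I)
    (s := 1 / (4 * W)) (t := 1 / 2) hδ (by norm_num)
    ((hF.mono hsub).const_mul _) (fun ζ hζ ↦ by simpa using him ζ (hsub hζ)) (by linarith)
    (by linarith)
  have h1 : ‖F z‖ ≤ ‖-I * F z + 1‖ + 1 := by
    have := norm_sub_le (-I * F z + 1) 1
    simpa using this
  have h2 : 4 * (W - 1 / (4 * W)) ^ 2 / (1 / (4 * W) * (1 / 2)) ≤ 32 * W ^ 3 := by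
    have : (W - 1 / (4 * W)) ^ 2 ≤ W ^ 2 := by
      gcongr
      · linarith
      · linarith
    calc 4 * (W - 1 / (4 * W)) ^ 2 / (1 / (4 * W) * (1 / 2))
        ≤ 4 * W ^ 2 / (1 / (4 * W) * (1 / 2)) := by gcongr
      _ = 32 * W ^ 3 := by field_simp; ring
  have h3 : 1 ≤ W ^ 3 := one_le_pow₀ (by linarith)
  calc ‖F z‖ ≤ 32 * W ^ 3 * ‖-I * F I + 1‖ + 1 := by
        have : 4 * (W - 1 / (4 * W)) ^ 2 / (1 / (4 * W) * (1 / 2)) * ‖-I * F I + 1‖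
          ≤ 32 * W ^ 3 * ‖-I * F I + 1‖ := by gcongr
        linarith
    _ ≤ _ := by nlinarith

/-- A holomorphic function on the upper half-plane with a lower bound polynomial in `wt`. -/
def IsLowerBdd (f : ℂ → ℂ) : Prop :=
  DifferentiableOn ℂ f uhp ∧ ∃ C, 0 < C ∧ ∀ z ∈ uhp, 1 ≤ C * wt z ^ 2 * ‖f z‖

lemma IsLowerBdd.ne_zero {f : ℂ → ℂ} (hf : IsLowerBdd f) {z : ℂ} (hz : z ∈ uhp) : f z ≠ 0 := by
  obtain ⟨-, C, -, h⟩ := hf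
  intro h0
  have := h z hz
  simp only [h0, norm_zero, mul_zero] at this
  linarith

lemma IsLowerBdd.exists_norm_logDeriv_le {f : ℂ → ℂ} (hf : IsLowerBdd f) :
    ∃ K, 0 < K ∧ ∀ z ∈ uhp, ‖logDeriv f z‖ ≤ K * wt z ^ 10 := by
  obtain ⟨hd, C, hC, hlow⟩ := hf
  refine ⟨512 * (289 * C * ‖f I‖ + 5), by positivity, fun z (hz : 0 < z.im) ↦ ?_⟩
  have hW := two_le_wt hz
  have hWy := one_le_wt_mul_im hz
  have hdist := dist_wt_add_le hz
  have hi := dist_I_add_le (ρ := wt z) (by linarith)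
  set W := wt z
  have hδ : 0 < 1 / (4 * W) := by positivity
  have hδ2 : 1 / (4 * W) ≤ z.im / 4 := by
    rw [div_le_div_iff₀ (by positivity) (by positivity)]
    linarith
  have hδ3 : 1 / (4 * W) ≤ 1 / 2 := by
    rw [div_le_div_iff₀ (by positivity) (by positivity)]
    linarith
  have hsub : ball ((W : ℂ) * I) (W - 1 / (4 * W)) ⊆ uhp := fun ζ hζ ↦
    hδ.trans (lt_im_of_mem_ball hζ)
  have hwt : ∀ ζ ∈ ball ((W : ℂ) * I) (W - 1 / (4 * W)), wt ζ ≤ 17 * W ^ 3 := fun ζ hζ ↦ by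
    refine (wt_le_of_mem_ball (by linarith) hδ hζ).trans ?_
    have : (1 + 4 * W ^ 2) / (1 / (4 * W)) = 4 * W + 16 * W ^ 3 := by field_simp; ring
    rw [this]
    nlinarith [mul_pos (by linarith : 0 < W) (by linarith : 0 < W)]
  have h := norm_logDeriv_le_of_one_le (f := f) (z := z) (w := I)
    (s := 1 / (4 * W)) (t := 1 / 2) (M := C * (17 * W ^ 3) ^ 2) hδ (by norm_num) (by positivity)
    (hd.mono hsub) (fun ζ hζ ↦ (hlow ζ (hsub hζ)).trans (by
      have := hwt ζ hζ
      have : 0 ≤ wt ζ := by linarith [two_le_wt (hsub hζ)]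
      gcongr)) (by linarith) (by linarith)
  have hlog : Real.log (C * (17 * W ^ 3) ^ 2 * ‖f I‖) ≤ C * (17 * W ^ 3) ^ 2 * ‖f I‖ :=
    Real.log_le_self (by positivity)
  have hW6 : 1 ≤ W ^ 6 := one_le_pow₀ (by linarith)
  have hR : (W - 1 / (4 * W)) ^ 2 ≤ W ^ 2 := by
    gcongr
    · linarith
    · linarith
  have hsum : Real.log (C * (17 * W ^ 3) ^ 2 * ‖f I‖) + 5 ≤ (289 * C * ‖f I‖ + 5) * W ^ 6 := by
    nlinarith
  calc ‖logDeriv f z‖ ≤ _ := h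
    _ ≤ 16 * (W - 1 / (4 * W)) ^ 2 / ((1 / (4 * W)) ^ 2 * (1 / 2))
        * ((289 * C * ‖f I‖ + 5) * W ^ 6) := by gcongr
    _ ≤ 16 * W ^ 2 / ((1 / (4 * W)) ^ 2 * (1 / 2)) * ((289 * C * ‖f I‖ + 5) * W ^ 6) := by gcongr
    _ = _ := by field_simp; ring

lemma IsLowerBdd.exists_norm_logDeriv_mul_I_le {f : ℂ → ℂ} (hf : IsLowerBdd f) :
    ∃ K, 0 < K ∧ ∀ ρ : ℝ, 1 ≤ ρ → ‖logDeriv f (ρ * I)‖ ≤ K * (1 + Real.log ρ) := by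
  have hfI : 0 < ‖f I‖ := norm_pos_iff.2 (hf.ne_zero (show (0 : ℝ) < I.im by simp))
  obtain ⟨hd, C, hC, hlow⟩ := hf
  refine ⟨32 * (|Real.log (100 * C * ‖f I‖)| + 5), by positivity, fun ρ hρ ↦ ?_⟩
  have hi := dist_I_add_le hρ
  have hsub : ball ((ρ : ℂ) * I) (ρ - 1 / 2) ⊆ uhp := fun ζ hζ ↦
    (by norm_num : (0 : ℝ) < 1 / 2).trans (lt_im_of_mem_ball hζ)
  have hwt : ∀ ζ ∈ ball ((ρ : ℂ) * I) (ρ - 1 / 2), wt ζ ≤ 10 * ρ ^ 2 := fun ζ hζ ↦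
    (wt_le_of_mem_ball (by linarith) (by norm_num) hζ).trans (by nlinarith)
  have h := norm_logDeriv_le_of_one_le (f := f) (z := ρ * I) (w := I)
    (s := ρ - 1 / 2) (t := 1 / 2) (M := C * (10 * ρ ^ 2) ^ 2) (by linarith) (by norm_num)
    (by positivity)
    (hd.mono hsub) (fun ζ hζ ↦ (hlow ζ (hsub hζ)).trans (by
      have := hwt ζ hζ
      have : 0 ≤ wt ζ := by linarith [two_le_wt (hsub hζ)]
      gcongr)) (by simp) (by linarith)
  have hlog : Real.log (C * (10 * ρ ^ 2) ^ 2 * ‖f I‖)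
      = Real.log (100 * C * ‖f I‖) + 4 * Real.log ρ := by
    rw [show C * (10 * ρ ^ 2) ^ 2 * ‖f I‖ = 100 * C * ‖f I‖ * ρ ^ 4 by ring,
      Real.log_mul (by positivity) (by positivity), Real.log_pow]
    norm_num
  have hc : 16 * (ρ - 1 / 2) ^ 2 / ((ρ - 1 / 2) ^ 2 * (1 / 2)) = 32 := by
    have : 0 < ρ - 1 / 2 := by linarith
    rw [div_eq_iff (by positivity)]
    ring
  rw [hc, hlog] at h
  have := le_abs_self (Real.log (100 * C * ‖f I‖))
  have := abs_nonneg (Real.log (100 * C * ‖f I‖))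
  have := Real.log_nonneg hρ
  nlinarith

/-- An entire function of polynomial growth is a polynomial. -/
lemma exists_polynomial_of_norm_le_pow {G : ℂ → ℂ} (hG : Differentiable ℂ G) {K : ℝ} {k : ℕ}
    (h : ∀ R : ℝ, 1 ≤ R → ∀ z : ℂ, ‖z‖ ≤ R → ‖G z‖ ≤ K * R ^ k) :
    ∃ p : Polynomial ℂ, ∀ z, G z = p.eval z := by
  have hz : ∀ n, k < n → iteratedDeriv n G 0 = 0 := by
    intro n hn
    rw [← norm_le_zero_iff]
    have hb : ∀ R : ℝ, 1 ≤ R → ‖iteratedDeriv n G 0‖ ≤ n.factorial * |K| / R := by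
      intro R hR
      have hR0 : 0 < R := by linarith
      refine (norm_iteratedDeriv_le_of_forall_mem_sphere_norm_le n hR0
        hG.diffContOnCl fun z hz ↦ (h R hR z ?_)).trans ?_
      · simpa using (mem_sphere.1 hz).le
      · rw [div_le_div_iff₀ (by positivity) hR0]
        have h1 : R ^ (k + 1) ≤ R ^ n := pow_le_pow_right₀ hR hn
        calc (n.factorial : ℝ) * (K * R ^ k) * R = n.factorial * K * R ^ (k + 1) := by ring
          _ ≤ n.factorial * |K| * R ^ (k + 1) := by
            gcongr
            exact le_abs_self K
          _ ≤ n.factorial * |K| * R ^ n := by gcongr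
    have hlim : Filter.Tendsto (fun R : ℝ ↦ n.factorial * |K| / R) Filter.atTop (nhds 0) :=
      Filter.Tendsto.const_div_atTop Filter.tendsto_id _
    exact ge_of_tendsto hlim (Filter.eventually_atTop.2 ⟨1, hb⟩)
  refine ⟨∑ n ∈ Finset.range (k + 1),
    Polynomial.C ((n.factorial : ℂ)⁻¹ * iteratedDeriv n G 0) * Polynomial.X ^ n, fun z ↦ ?_⟩
  rw [← taylorSeries_eq_of_entire' 0 z hG, tsum_eq_sum (s := Finset.range (k + 1))]
  · simp [Polynomial.eval_finsetSum]
  · intro n hn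
    rw [hz n (by simpa using hn)]
    simp

lemma norm_le_of_norm_le_wt_pow {G : ℂ → ℂ} (hG : Differentiable ℂ G) {K : ℝ} (hK : 0 < K) {k : ℕ}
    (hk : k ≠ 0) (hsymm : ∀ z, ‖G (starRingEnd ℂ z)‖ = ‖G z‖)
    (h : ∀ z ∈ uhp, ‖G z‖ ≤ K * wt z ^ k)
    {R : ℝ} (hR : 1 ≤ R) {z : ℂ} (hz : ‖z‖ ≤ R) : ‖G z‖ ≤ K * 16 ^ k * R ^ k := by
  have hup : ∀ ζ : ℂ, ‖ζ‖ = 2 * R → 0 < ζ.im →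
      ‖G ζ‖ * (2 * (2 * R) * |ζ.im|) ^ k ≤ K * (32 * R ^ 3) ^ k := by
    intro ζ hζ him
    have h1 := h ζ him
    have h2 := wt_mul_im him
    rw [hζ] at h2
    have hw := two_le_wt him
    rw [abs_of_pos him]
    calc ‖G ζ‖ * (2 * (2 * R) * ζ.im) ^ k ≤ K * wt ζ ^ k * (2 * (2 * R) * ζ.im) ^ k := by gcongr
      _ = K * (4 * R * (wt ζ * ζ.im)) ^ k := by
        rw [mul_assoc, ← mul_pow]
        ring
      _ ≤ K * (32 * R ^ 3) ^ k := by
        have : 4 * R * (1 + (2 * R) ^ 2) ≤ 32 * R ^ 3 := by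
          nlinarith [mul_nonneg (by linarith : 0 ≤ R) (by nlinarith : 0 ≤ R ^ 2 - 1)]
        rw [h2]
        gcongr
  have hcirc : ∀ ζ ∈ frontier (ball (0 : ℂ) (2 * R)),
      ‖G ζ * (ζ ^ 2 - (2 * R : ℝ) ^ 2) ^ k‖ ≤ K * (32 * R ^ 3) ^ k := by
    intro ζ hζ
    rw [frontier_ball _ (by linarith), mem_sphere_zero_iff_norm] at hζ
    have hn : ‖ζ ^ 2 - ((2 * R : ℝ) : ℂ) ^ 2‖ = 2 * (2 * R) * |ζ.im| := by
      have : ζ ^ 2 - ((2 * R : ℝ) : ℂ) ^ 2 = ζ * (ζ - starRingEnd ℂ ζ) := by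
        rw [mul_sub, mul_conj, normSq_eq_norm_sq, hζ]
        push_cast
        ring
      rw [this, sub_conj, norm_mul, hζ, norm_mul, norm_I, norm_real, Real.norm_eq_abs, abs_mul,
        abs_two]
      ring
    rw [norm_mul, norm_pow, hn]
    rcases lt_trichotomy ζ.im 0 with hlt | heq | hgt
    · have := hup (starRingEnd ℂ ζ) (by simpa using hζ) (by simpa using hlt)
      rwa [hsymm, conj_im, abs_neg] at this
    · rw [heq, abs_zero, mul_zero, zero_pow hk, mul_zero]
      positivity
    · exact hup ζ hζ hgt
  have hmax := norm_le_of_forall_mem_frontier_norm_le (U := ball (0 : ℂ) (2 * R))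
    (f := fun ζ ↦ G ζ * (ζ ^ 2 - (2 * R : ℝ) ^ 2) ^ k) isBounded_ball
    (Differentiable.diffContOnCl (by fun_prop)) hcirc (z := z)
    (subset_closure (by rw [mem_ball_zero_iff]; linarith))
  rw [norm_mul, norm_pow] at hmax
  have hlow : 2 * R ^ 2 ≤ ‖z ^ 2 - ((2 * R : ℝ) : ℂ) ^ 2‖ := by
    have h1 := norm_sub_norm_le (((2 * R : ℝ) : ℂ) ^ 2) (z ^ 2)
    rw [norm_sub_rev, norm_pow, norm_pow, norm_real, Real.norm_of_nonneg (by linarith)] at h1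
    nlinarith [norm_nonneg z]
  have h3 : ‖G z‖ * (2 * R ^ 2) ^ k ≤ K * (32 * R ^ 3) ^ k := le_trans (by gcongr) hmax
  have h4 : K * (32 * R ^ 3) ^ k = K * 16 ^ k * R ^ k * (2 * R ^ 2) ^ k := by
    rw [mul_assoc K, mul_assoc K, ← mul_pow, ← mul_pow]
    ring
  rw [h4] at h3
  exact le_of_mul_le_mul_right h3 (by positivity)

lemma Polynomial.eq_C_of_norm_eval_mul_I_le {p : Polynomial ℂ} {K : ℝ}
    (h : ∀ ρ : ℝ, 1 ≤ ρ → ‖p.eval (ρ * I)‖ ≤ K * (1 + Real.log ρ)) :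
    p = Polynomial.C (p.eval 0) := by
  have hnorm : Filter.Tendsto (fun ρ : ℝ ↦ ‖(ρ : ℂ) * I‖) Filter.atTop Filter.atTop := by
    simpa using Filter.tendsto_abs_atTop_atTop
  have hq : Filter.Tendsto (fun ρ : ℝ ↦ ‖p.divX.eval ((ρ : ℂ) * I)‖) Filter.atTop (nhds 0) := by
    have hlim : Filter.Tendsto (fun ρ : ℝ ↦ (K + ‖p.coeff 0‖) / ρ + K * (Real.log ρ / ρ))
        Filter.atTop (nhds 0) := by
      have h1 : Filter.Tendsto (fun ρ : ℝ ↦ (K + ‖p.coeff 0‖) / ρ) Filter.atTop (nhds 0) :=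
        Filter.Tendsto.const_div_atTop Filter.tendsto_id _
      have h2 : Filter.Tendsto (fun ρ : ℝ ↦ Real.log ρ / ρ) Filter.atTop (nhds 0) :=
        Real.isLittleO_log_id_atTop.tendsto_div_nhds_zero
      simpa using h1.add (h2.const_mul K)
    refine squeeze_zero' (Filter.Eventually.of_forall fun _ ↦ norm_nonneg _)
      (Filter.eventually_atTop.2 ⟨1, fun ρ hρ ↦ ?_⟩) hlim
    have hρ0 : 0 < ρ := by linarith
    have he : p.divX.eval ((ρ : ℂ) * I) * (ρ * I) = p.eval (ρ * I) - p.coeff 0 := by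
      conv_rhs => rw [← Polynomial.divX_mul_X_add p]
      simp
    have hn := congrArg norm he
    rw [norm_mul, norm_mul, norm_I, mul_one, norm_real, Real.norm_of_nonneg hρ0.le] at hn
    have h5 := norm_sub_le (p.eval ((ρ : ℂ) * I)) (p.coeff 0)
    have h6 := h ρ hρ
    have h7 : (K + ‖p.coeff 0‖) / ρ + K * (Real.log ρ / ρ)
        = (K + ‖p.coeff 0‖ + K * Real.log ρ) / ρ := by ring
    rw [h7, le_div_iff₀ hρ0, hn]
    linarith
  have hdeg : ¬ 0 < p.divX.degree := fun hdeg ↦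
    not_tendsto_nhds_of_tendsto_atTop (p.divX.tendsto_norm_atTop hdeg hnorm) _ hq
  have hC := Polynomial.eq_C_of_degree_le_zero (not_lt.1 hdeg)
  rw [hC] at hq
  simp only [Polynomial.eval_C] at hq
  have h0 : p.divX.coeff 0 = 0 := norm_eq_zero.1 (tendsto_nhds_unique tendsto_const_nhds hq)
  rw [h0, map_zero] at hC
  rw [← Polynomial.divX_mul_X_add p, hC]
  simp

/-- An entire function that is a difference of two logarithmic derivatives on the upper half-plane
of functions that are not too small, is constant. -/
lemma eq_apply_zero_of_eq_logDeriv_sub {G f₁ f₂ : ℂ → ℂ} (hG : Differentiable ℂ G)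
    (hsymm : ∀ z, ‖G (starRingEnd ℂ z)‖ = ‖G z‖) (h₁ : IsLowerBdd f₁) (h₂ : IsLowerBdd f₂)
    (h : ∀ z ∈ uhp, G z = logDeriv f₁ z - logDeriv f₂ z) (z : ℂ) : G z = G 0 := by
  obtain ⟨K₁, hK₁, hb₁⟩ := h₁.exists_norm_logDeriv_le
  obtain ⟨K₂, hK₂, hb₂⟩ := h₂.exists_norm_logDeriv_le
  obtain ⟨L₁, -, hl₁⟩ := h₁.exists_norm_logDeriv_mul_I_le
  obtain ⟨L₂, -, hl₂⟩ := h₂.exists_norm_logDeriv_mul_I_le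
  have hb : ∀ z ∈ uhp, ‖G z‖ ≤ (K₁ + K₂) * wt z ^ 10 := fun z hz ↦ by
    rw [h z hz, add_mul]
    exact (norm_sub_le _ _).trans (add_le_add (hb₁ z hz) (hb₂ z hz))
  obtain ⟨p, hp⟩ := exists_polynomial_of_norm_le_pow hG fun R hR z hz ↦
    norm_le_of_norm_le_wt_pow hG (add_pos hK₁ hK₂) (by norm_num) hsymm hb hR hz
  have hpc := Polynomial.eq_C_of_norm_eval_mul_I_le (p := p) (K := L₁ + L₂) fun ρ hρ ↦ by
    rw [← hp, h _ (show (0 : ℝ) < (ρ * I : ℂ).im by simp; linarith), add_mul]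
    exact (norm_sub_le _ _).trans (add_le_add (hl₁ ρ hρ) (hl₂ ρ hρ))
  rw [hp, hp, hpc]
  simp

lemma re_I_mul_mul_log_sub_le {z : ℂ} {R : ℝ} (hR : 1 ≤ R) (him : 1 ≤ z.im)
    (hb : ‖z‖ = R ∨ z.im = 1) :
    (I * z * (log z - Real.log R)).re - Real.log R ≤ Real.pi * max 0 (-z.re) := by
  have hre : (I * z * (log z - Real.log R)).re
      = -(z.re * arg z) + z.im * (Real.log R - Real.log ‖z‖) := by
    simp only [mul_re, mul_im, I_re, I_im, sub_re, sub_im, log_re, log_im, ofReal_re, ofReal_im]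
    ring
  have harg0 : 0 ≤ arg z := arg_nonneg_iff.2 (by linarith)
  have hargπ : arg z ≤ Real.pi := arg_le_pi z
  have h1 : -(z.re * arg z) ≤ Real.pi * max 0 (-z.re) := by
    have h2 : -z.re ≤ max 0 (-z.re) := le_max_right _ _
    have h3 : 0 ≤ max 0 (-z.re) := le_max_left _ _
    nlinarith
  have h2 : z.im * (Real.log R - Real.log ‖z‖) ≤ Real.log R := by
    rcases hb with hb | hb
    · rw [hb, sub_self, mul_zero]
      exact Real.log_nonneg hR
    · have : 1 ≤ ‖z‖ := him.trans ((le_abs_self _).trans (abs_im_le_norm z))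
      have := Real.log_nonneg this
      rw [hb]
      linarith
  rw [hre]
  linarith

lemma wt_sq_le {z : ℂ} (him : 1 ≤ z.im) : wt z ^ 2 ≤ ‖(z + I) ^ 4‖ := by
  have h0 : 0 < z.im := by linarith
  have h1 : wt z ≤ ‖z + I‖ ^ 2 := by
    have h2 := wt_mul_im h0
    have h3 := two_le_wt h0
    have h4 := norm_sq_eq_re_im (z + I)
    rw [norm_sq_eq_re_im] at h2
    simp only [add_re, add_im, I_re, I_im] at h4
    nlinarith
  have h3 := two_le_wt h0
  rw [norm_pow, show ‖z + I‖ ^ 4 = (‖z + I‖ ^ 2) ^ 2 by ring]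
  gcongr

/-- The reciprocal of a holomorphic function on the upper half-plane cannot decay exponentially
along one half of the real direction while being of polynomial growth throughout. -/
lemma not_forall_one_le_exp_mul_norm {f : ℂ → ℂ} {a C : ℝ} (ha : 0 < a) (hC : 0 < C)
    (hf : DifferentiableOn ℂ f uhp) (h₁ : ∀ z ∈ uhp, 1 ≤ C * wt z ^ 2 * ‖f z‖) :
    ¬ ∀ z ∈ uhp, 1 ≤ C * wt z ^ 2 * (Real.exp (a * z.re) * ‖f z‖) := by
  intro h₂
  have hπ := Real.pi_pos
  set g : ℂ → ℂ := fun z ↦ f z * (z + I) ^ 4 with hg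
  have hlow : ∀ z : ℂ, 1 ≤ z.im → Real.exp (a * max 0 (-z.re)) ≤ C * ‖g z‖ := by
    intro z hz
    have hz0 : z ∈ uhp := show 0 < z.im by linarith
    have hw := wt_sq_le hz
    rw [hg, norm_mul]
    rcases le_total 0 z.re with hx | hx
    · rw [max_eq_left (by linarith), mul_zero, Real.exp_zero]
      calc 1 ≤ C * wt z ^ 2 * ‖f z‖ := h₁ z hz0
        _ ≤ C * ‖(z + I) ^ 4‖ * ‖f z‖ := by gcongr
        _ = _ := by ring
    · rw [max_eq_right (by linarith), mul_neg, Real.exp_neg, inv_le_iff_one_le_mul₀ (by positivity)]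
      calc 1 ≤ C * wt z ^ 2 * (Real.exp (a * z.re) * ‖f z‖) := h₂ z hz0
        _ ≤ C * ‖(z + I) ^ 4‖ * (Real.exp (a * z.re) * ‖f z‖) := by gcongr
        _ = _ := by ring
  have hgne : ∀ z : ℂ, 1 ≤ z.im → g z ≠ 0 := fun z hz h0 ↦ by
    have := hlow z hz
    rw [h0, norm_zero, mul_zero] at this
    linarith [Real.exp_pos (a * max 0 (-z.re))]
  have hkey : ∀ R : ℝ, 3 < R →
      Real.exp (a / Real.pi * (2 * Real.log R - 3 * Real.log 3)) ≤ C * ‖g (3 * I)‖ := by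
    intro R hR
    set U : Set ℂ := ball 0 R ∩ {z | 1 < z.im} with hU
    have hUo : IsOpen U := isOpen_ball.inter (isOpen_lt continuous_const continuous_im)
    have hcl : closure U ⊆ closedBall 0 R ∩ {z | 1 ≤ z.im} :=
      closure_minimal (fun z hz ↦ ⟨ball_subset_closedBall hz.1, (show (1 : ℝ) < z.im from hz.2).le⟩)
        (isClosed_closedBall.inter (isClosed_le continuous_const continuous_im))
    have hdiff : DifferentiableOn ℂ (fun z ↦
        exp ((a / Real.pi : ℝ) * (I * z * (log z - Real.log R) - Real.log R)) / g z)
        (closure U) := by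
      intro z hz
      have hz1 : 1 ≤ z.im := (hcl hz).2
      have hz0 : 0 < z.im := by linarith
      have hlog : DifferentiableAt ℂ log z := differentiableAt_log (Or.inr hz0.ne')
      have hfz : DifferentiableAt ℂ f z := hf.differentiableAt (isOpen_uhp.mem_nhds hz0)
      have hgz : DifferentiableAt ℂ g z := by
        rw [hg]
        fun_prop
      refine DifferentiableAt.differentiableWithinAt (DifferentiableAt.div ?_ hgz (hgne z hz1))
      fun_prop
    have hbd : ∀ z ∈ frontier U,
        ‖exp ((a / Real.pi : ℝ) * (I * z * (log z - Real.log R) - Real.log R)) / g z‖ ≤ C := by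
      intro z hz
      have hz1 := hcl hz.1
      have hb : ‖z‖ = R ∨ z.im = 1 := by
        by_contra! hne
        apply hz.2
        rw [hUo.interior_eq]
        exact ⟨mem_ball_zero_iff.2 (lt_of_le_of_ne (mem_closedBall_zero_iff.1 hz1.1) hne.1),
          lt_of_le_of_ne hz1.2 hne.2.symm⟩
      have h3 := re_I_mul_mul_log_sub_le (by linarith) hz1.2 hb
      rw [norm_div, norm_exp, re_ofReal_mul, sub_re, ofReal_re,
        div_le_iff₀ (norm_pos_iff.2 (hgne z hz1.2))]
      refine le_trans (Real.exp_le_exp.2 ?_) (hlow z hz1.2)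
      calc _ ≤ a / Real.pi * (Real.pi * max 0 (-z.re)) := by gcongr
        _ = _ := by field_simp
    have h3U : (3 * I : ℂ) ∈ closure U := subset_closure ⟨by simpa using hR, by simp⟩
    have h := norm_le_of_forall_mem_frontier_norm_le (isBounded_ball.subset inter_subset_left)
      hdiff.diffContOnCl hbd h3U
    have harg : (I * (3 * I) * (log (3 * I) - Real.log R)).re = 3 * (Real.log R - Real.log 3) := by
      have : I * (3 * I) = ((-3 : ℝ) : ℂ) := by
        push_cast
        linear_combination (3 : ℂ) * I_mul_I
      rw [this, re_ofReal_mul, sub_re, log_re, ofReal_re]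
      simp
      ring
    rw [norm_div, norm_exp, re_ofReal_mul, sub_re, ofReal_re, harg,
        div_le_iff₀ (norm_pos_iff.2 (hgne _ (by simp)))] at h
    rwa [show 3 * (Real.log R - Real.log 3) - Real.log R
      = 2 * Real.log R - 3 * Real.log 3 by ring] at h
  have hlim : Filter.Tendsto
      (fun R : ℝ ↦ Real.exp (a / Real.pi * (2 * Real.log R - 3 * Real.log 3)))
      Filter.atTop Filter.atTop := by
    refine Real.tendsto_exp_atTop.comp (Filter.Tendsto.const_mul_atTop (by positivity) ?_)
    exact Filter.tendsto_atTop_add_const_right _ _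
      (Real.tendsto_log_atTop.const_mul_atTop (by norm_num))
  obtain ⟨R, hR1, hR2⟩ :=
    ((hlim.eventually_gt_atTop (C * ‖g (3 * I)‖)).and (Filter.eventually_gt_atTop 3)).exists
  exact absurd (hkey R hR2) (not_le.2 hR1)

lemma IsLowerBdd.eq_zero_of_eq_exp_mul {f₁ f₂ : ℂ → ℂ} (h₁ : IsLowerBdd f₁) (h₂ : IsLowerBdd f₂)
    {a : ℝ} (h : ∀ z ∈ uhp, f₁ z = exp (a * z) * f₂ z) : a = 0 := by
  obtain ⟨hd₁, C₁, hC₁, hl₁⟩ := h₁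
  obtain ⟨hd₂, C₂, hC₂, hl₂⟩ := h₂
  have hl₁' : ∀ z ∈ uhp, 1 ≤ max C₁ C₂ * wt z ^ 2 * ‖f₁ z‖ := fun z hz ↦
    (hl₁ z hz).trans (by
      gcongr
      exact le_max_left _ _)
  have hl₂' : ∀ z ∈ uhp, 1 ≤ max C₁ C₂ * wt z ^ 2 * ‖f₂ z‖ := fun z hz ↦
    (hl₂ z hz).trans (by
      gcongr
      exact le_max_right _ _)
  have hC : 0 < max C₁ C₂ := lt_max_of_lt_left hC₁
  have hn : ∀ z ∈ uhp, ‖f₁ z‖ = Real.exp (a * z.re) * ‖f₂ z‖ := fun z hz ↦ by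
    rw [h z hz, norm_mul, norm_exp, re_ofReal_mul]
  rcases lt_trichotomy a 0 with ha | ha | ha
  · refine absurd (fun z hz ↦ ?_)
      (not_forall_one_le_exp_mul_norm (neg_pos.2 ha) hC hd₁ hl₁')
    rw [hn z hz, ← mul_assoc (Real.exp _), ← Real.exp_add]
    simpa using hl₂' z hz
  · exact ha
  · refine absurd (fun z hz ↦ ?_) (not_forall_one_le_exp_mul_norm ha hC hd₂ hl₂')
    rw [← hn z hz]
    exact hl₁' z hz

lemma deriv_conj_of_apply_conj {h : ℂ → ℂ}
    (hconj : ∀ z, h (starRingEnd ℂ z) = starRingEnd ℂ (h z)) (z : ℂ) :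
    deriv h (starRingEnd ℂ z) = starRingEnd ℂ (deriv h z) := by
  have h1 : (starRingEnd ℂ) ∘ h ∘ (starRingEnd ℂ) = h := by
    ext w
    simp [hconj]
  have h2 := congrFun (deriv_conj_conj (𝕜 := ℂ) (f := h)) (starRingEnd ℂ z)
  rw [h1] at h2
  simpa using h2

namespace IsTM

variable {T T' : ℂ → Matrix (Fin 2) (Fin 2) ℂ}

lemma det_eq (hT : IsTM T) (z : ℂ) : T z 0 0 * T z 1 1 - T z 0 1 * T z 1 0 = 1 := by
  rw [← det_fin_two, hT.det_one]

lemma apply_conj (hT : IsTM T) (i j : Fin 2) (z : ℂ) :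
    T (starRingEnd ℂ z) i j = starRingEnd ℂ (T z i j) := by
  rw [hT.conj_symm, map_apply]

lemma one_le_im_mul_conj (hT : IsTM T) {z : ℂ} (hz : 0 ≤ z.im) :
    1 ≤ ((T z 1 0 + I * T z 1 1) * starRingEnd ℂ (T z 0 0 + I * T z 0 1)).im := by
  have h := (Complex.nonneg_iff.1 ((hT.psd z hz).dotProduct_mulVec_nonneg ![1, I])).1
  simp [Jmat, Matrix.mul_apply, Fin.sum_univ_two, dotProduct, mulVec] at h
  simp
  linarith

lemma add_I_mul_ne_zero (hT : IsTM T) {z : ℂ} (hz : z ∈ uhp) : T z 0 0 + I * T z 0 1 ≠ 0 := by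
  intro h
  have := hT.one_le_im_mul_conj (le_of_lt hz)
  rw [h, map_zero, mul_zero, zero_im] at this
  linarith

lemma differentiableOn_mobius (hT : IsTM T) :
    DifferentiableOn ℂ (fun z ↦ (T z 1 0 + I * T z 1 1) / (T z 0 0 + I * T z 0 1)) uhp := by
  have := hT.entire
  refine DifferentiableOn.div ?_ ?_ fun z hz ↦ hT.add_I_mul_ne_zero hz
  · exact ((hT.entire 1 0).add ((hT.entire 1 1).const_mul I)).differentiableOn
  · exact ((hT.entire 0 0).add ((hT.entire 0 1).const_mul I)).differentiableOn

lemma inv_norm_sq_le_im_mobius (hT : IsTM T) {z : ℂ} (hz : z ∈ uhp) :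
    (‖T z 0 0 + I * T z 0 1‖ ^ 2)⁻¹
      ≤ ((T z 1 0 + I * T z 1 1) / (T z 0 0 + I * T z 0 1)).im := by
  have h := hT.one_le_im_mul_conj (le_of_lt hz)
  have hn : 0 < ‖T z 0 0 + I * T z 0 1‖ := norm_pos_iff.2 (hT.add_I_mul_ne_zero hz)
  have e : ((T z 1 0 + I * T z 1 1) / (T z 0 0 + I * T z 0 1)).im
      = ((T z 1 0 + I * T z 1 1) * starRingEnd ℂ (T z 0 0 + I * T z 0 1)).im
        * (‖T z 0 0 + I * T z 0 1‖ ^ 2)⁻¹ := by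
    rw [div_eq_mul_inv, inv_def, ← mul_assoc, im_mul_ofReal, normSq_eq_norm_sq]
  rw [e]
  exact le_mul_of_one_le_left (by positivity) h

lemma im_mobius_nonneg (hT : IsTM T) {z : ℂ} (hz : z ∈ uhp) :
    0 ≤ ((T z 1 0 + I * T z 1 1) / (T z 0 0 + I * T z 0 1)).im :=
  le_trans (by positivity) (hT.inv_norm_sq_le_im_mobius hz)

lemma isLowerBdd_add_I_mul (hT : IsTM T) : IsLowerBdd fun z ↦ T z 0 0 + I * T z 0 1 := by
  refine ⟨((hT.entire 0 0).add ((hT.entire 0 1).const_mul I)).differentiableOn, ?_⟩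
  obtain ⟨C, hC, hb⟩ := exists_norm_le_wt_of_im_nonneg hT.differentiableOn_mobius
    fun z hz ↦ hT.im_mobius_nonneg hz
  refine ⟨C + 1, by positivity, fun z hz ↦ ?_⟩
  have hn : 0 < ‖T z 0 0 + I * T z 0 1‖ := norm_pos_iff.2 (hT.add_I_mul_ne_zero hz)
  have h := (hT.inv_norm_sq_le_im_mobius hz).trans
    ((le_abs_self _).trans ((abs_im_le_norm _).trans (hb z hz)))
  rw [inv_le_iff_one_le_mul₀ (by positivity)] at h
  have hw := two_le_wt hz
  have h3 : wt z ^ 3 ≤ wt z ^ 4 := pow_le_pow_right₀ (by linarith) (by norm_num)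
  have hsq : (1 : ℝ) ^ 2 ≤ ((C + 1) * wt z ^ 2 * ‖T z 0 0 + I * T z 0 1‖) ^ 2 := by
    calc (1 : ℝ) ^ 2 ≤ C * wt z ^ 3 * ‖T z 0 0 + I * T z 0 1‖ ^ 2 := by simpa using h
      _ ≤ (C + 1) ^ 2 * wt z ^ 4 * ‖T z 0 0 + I * T z 0 1‖ ^ 2 := by
        gcongr
        nlinarith
      _ = _ := by ring
  exact le_of_sq_le_sq hsq (by positivity)

lemma isLowerBdd_exp_mobius (hT : IsTM T) :
    IsLowerBdd fun z ↦ exp (-I * ((T z 1 0 + I * T z 1 1) / (T z 0 0 + I * T z 0 1))) := by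
  refine ⟨(hT.differentiableOn_mobius.const_mul _).cexp, 1, one_pos, fun z hz ↦ ?_⟩
  have hw := two_le_wt hz
  have h := hT.im_mobius_nonneg hz
  have he : 1 ≤ ‖exp (-I * ((T z 1 0 + I * T z 1 1) / (T z 0 0 + I * T z 0 1)))‖ := by
    rw [norm_exp, Real.one_le_exp_iff]
    simpa using h
  rw [one_mul]
  exact one_le_mul_of_one_le_of_one_le (one_le_pow₀ (by linarith)) he

/-- The top row of a transfer matrix is determined by its `m`-function. -/
lemma top_row_eq (hT : IsTM T) (hT' : IsTM T')
    (hm : ∀ z, T z 0 1 * T' z 0 0 = T' z 0 1 * T z 0 0) (z : ℂ) :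
    T' z 0 0 = T z 0 0 ∧ T' z 0 1 = T z 0 1 := by
  set E : ℂ → ℂ := fun z ↦ T' z 0 0 * T z 1 1 - T' z 0 1 * T z 1 0 with hE
  set E' : ℂ → ℂ := fun z ↦ T z 0 0 * T' z 1 1 - T z 0 1 * T' z 1 0 with hE'
  have hA : ∀ z, T' z 0 0 = E z * T z 0 0 := fun z ↦ by
    simp only [hE]
    linear_combination (-T' z 0 0) * hT.det_eq z - T z 1 0 * hm z
  have hB : ∀ z, T' z 0 1 = E z * T z 0 1 := fun z ↦ by
    simp only [hE]
    linear_combination (-T' z 0 1) * hT.det_eq z - T z 1 1 * hm z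
  have hEE : ∀ z, E z * E' z = 1 := fun z ↦ by
    simp only [hE']
    linear_combination hT'.det_eq z - T' z 1 1 * hA z + T' z 1 0 * hB z
  have hEne : ∀ z, E z ≠ 0 := fun z h ↦ by simpa [h] using hEE z
  have hEd : Differentiable ℂ E :=
    ((hT'.entire 0 0).mul (hT.entire 1 1)).sub ((hT'.entire 0 1).mul (hT.entire 1 0))
  have hEconj : ∀ z, E (starRingEnd ℂ z) = starRingEnd ℂ (E z) := fun z ↦ by
    simp only [hE, hT.apply_conj, hT'.apply_conj, map_sub, map_mul]
  have hE0 : E 0 = 1 := by simp [hE, hT.init, hT'.init]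
  have hGconj : ∀ z, logDeriv E (starRingEnd ℂ z) = starRingEnd ℂ (logDeriv E z) := fun z ↦ by
    rw [logDeriv_apply, logDeriv_apply, hEconj, deriv_conj_of_apply_conj hEconj, map_div₀]
  have hGd : Differentiable ℂ (logDeriv E) := hEd.deriv.div hEd hEne
  have hrel : ∀ z, T' z 0 0 + I * T' z 0 1 = E z * (T z 0 0 + I * T z 0 1) := fun z ↦ by
    rw [hA, hB]
    ring
  have hlb := hT.isLowerBdd_add_I_mul
  have hlb' := hT'.isLowerBdd_add_I_mul
  have hconst := eq_apply_zero_of_eq_logDeriv_sub hGd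
    (fun z ↦ by rw [hGconj, RCLike.norm_conj]) hlb' hlb (fun z hz ↦ by
      have : (fun z ↦ T' z 0 0 + I * T' z 0 1) = fun z ↦ E z * (T z 0 0 + I * T z 0 1) :=
        funext hrel
      rw [this, logDeriv_mul z (hEne z) (hT.add_I_mul_ne_zero hz) (hEd z)
        ((hlb.1).differentiableAt (isOpen_uhp.mem_nhds hz)), add_sub_cancel_right])
  obtain ⟨a, ha⟩ : ∃ a : ℝ, logDeriv E 0 = a := by
    have h := hGconj 0
    rw [map_zero] at h
    exact ⟨_, (conj_eq_iff_re.1 h.symm).symm⟩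
  have hexp : ∀ z, E z = exp (a * z) := fun z ↦ by
    have hd : ∀ w, HasDerivAt (fun w ↦ E w * exp (-(a * w))) 0 w := fun w ↦ by
      have h1 := (hEd w).hasDerivAt.mul ((hasDerivAt_id w).const_mul (a : ℂ)).neg.cexp
      have h2 := hconst w
      rw [ha, logDeriv_apply, div_eq_iff (hEne w)] at h2
      refine h1.congr_deriv ?_
      rw [h2]
      simp
      ring
    have h := is_const_of_deriv_eq_zero (fun w ↦ (hd w).differentiableAt) (fun w ↦ (hd w).deriv) z 0
    simp only [hE0, mul_zero, neg_zero, Complex.exp_zero, mul_one, Complex.exp_neg] at h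
    rw [← div_eq_mul_inv, div_eq_one_iff_eq (Complex.exp_ne_zero _)] at h
    exact h
  have ha0 : a = 0 := hlb'.eq_zero_of_eq_exp_mul hlb fun z _ ↦ by rw [hrel, hexp]
  rw [hA, hB, hexp, ha0]
  simp

/-- A transfer matrix is determined by its top row and the derivative at `0` of its lower left
entry. -/
lemma eq_of_top_row_eq (hT : IsTM T) (hT' : IsTM T')
    (hA : ∀ z, T' z 0 0 = T z 0 0) (hB : ∀ z, T' z 0 1 = T z 0 1)
    (hder : deriv (fun z ↦ T' z 1 0) 0 = deriv (fun z ↦ T z 1 0) 0) : T = T' := by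
  set h : ℂ → ℂ := fun z ↦ T' z 1 0 * T z 1 1 - T' z 1 1 * T z 1 0 with hh
  have hC : ∀ z, T' z 1 0 = T z 1 0 + h z * T z 0 0 := fun z ↦ by
    have h1 := hT'.det_eq z
    rw [hA, hB] at h1
    simp only [hh]
    linear_combination (-T' z 1 0) * hT.det_eq z + T z 1 0 * h1
  have hD : ∀ z, T' z 1 1 = T z 1 1 + h z * T z 0 1 := fun z ↦ by
    have h1 := hT'.det_eq z
    rw [hA, hB] at h1
    simp only [hh]
    linear_combination (-T' z 1 1) * hT.det_eq z + T z 1 1 * h1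
  have hd : Differentiable ℂ h :=
    ((hT'.entire 1 0).mul (hT.entire 1 1)).sub ((hT'.entire 1 1).mul (hT.entire 1 0))
  have hconj : ∀ z, h (starRingEnd ℂ z) = starRingEnd ℂ (h z) := fun z ↦ by
    simp only [hh, hT.apply_conj, hT'.apply_conj, map_sub, map_mul]
  have hdconj := deriv_conj_of_apply_conj hconj
  have h0 : h 0 = 0 := by simp [hh, hT.init, hT'.init]
  have hconst := eq_apply_zero_of_eq_logDeriv_sub (G := fun z ↦ -I * deriv h z)
    (hd.deriv.const_mul _) (fun z ↦ by simp [hdconj]) hT'.isLowerBdd_exp_mobius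
    hT.isLowerBdd_exp_mobius (fun z hz ↦ by
      have hfun : (fun z ↦ (T' z 1 0 + I * T' z 1 1) / (T' z 0 0 + I * T' z 0 1)) =ᶠ[nhds z]
          fun z ↦ (T z 1 0 + I * T z 1 1) / (T z 0 0 + I * T z 0 1) + h z := by
        filter_upwards [isOpen_uhp.mem_nhds hz] with w hw
        have := hT.add_I_mul_ne_zero hw
        rw [hA, hB, hC, hD]
        field_simp
        ring
      have hdF := hT.differentiableOn_mobius.differentiableAt (isOpen_uhp.mem_nhds hz)
      have hdF' := hT'.differentiableOn_mobius.differentiableAt (isOpen_uhp.mem_nhds hz)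
      have hder' := hfun.deriv_eq
      rw [deriv_fun_add hdF (hd z)] at hder'
      have hl : ∀ F : ℂ → ℂ, DifferentiableAt ℂ F z →
          logDeriv (fun w ↦ exp (-I * F w)) z = -I * deriv F z := fun F hF ↦ by
        rw [logDeriv_apply, (hF.hasDerivAt.const_mul (-I)).cexp.deriv,
          mul_div_cancel_left₀ _ (Complex.exp_ne_zero _)]
      rw [hl _ hdF, hl _ hdF', hder']
      ring)
  have hder0 : deriv h 0 = 0 := by
    have h1 : (fun z ↦ T' z 1 0) = fun z ↦ T z 1 0 + h z * T z 0 0 := funext hC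
    have h2 : deriv (fun z ↦ T z 1 0 + h z * T z 0 0) 0 = _ :=
      ((hT.entire 1 0 0).hasDerivAt.add
        ((hd 0).hasDerivAt.mul (hT.entire 0 0 0).hasDerivAt)).deriv
    rw [h1, h2] at hder
    simpa [h0, hT.init] using hder
  have hz : ∀ z, h z = 0 := fun z ↦ by
    rw [is_const_of_deriv_eq_zero hd (fun w ↦ ?_) z 0, h0]
    simpa [hder0] using hconst w
  ext z i j
  fin_cases i <;> fin_cases j
  · exact (hA z).symm
  · exact (hB z).symm
  · simpa [hz z] using (hC z).symm
  · simpa [hz z] using (hD z).symm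

end IsTM

end

/-- If two transfer matrices in `TM(L)`, `L > 0`, have the same Weyl
`m`-function with Dirichlet–Neumann boundary conditions, i.e. `−B/A = −B̃/Ã`
(equivalently `B Ã = B̃ A` everywhere), then they coincide. -/
theorem transfer_matrix_unique_from_mfunction
    (L : ℝ) (hL : 0 < L)
    (T T' : ℂ → Matrix (Fin 2) (Fin 2) ℂ)
    (hT : IsTML L T) (hT' : IsTML L T')
    (hm : ∀ z : ℂ, T z 0 1 * T' z 0 0 = T' z 0 1 * T z 0 0) :
    T = T' := by
  have hrow := hT.1.top_row_eq hT'.1 hm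
  refine hT.1.eq_of_top_row_eq hT'.1 (fun z ↦ (hrow z).1) (fun z ↦ (hrow z).2) ?_
  have hB : (fun z ↦ T' z 0 1) = fun z ↦ T z 0 1 := funext fun z ↦ (hrow z).2
  have h := hT'.2.trans hT.2.symm
  rw [hB] at h
  exact sub_left_injective h
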